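/- arXiv:1405.5979 — 3 statements merged into one kernel-verified Lean document; each statement's English description precedes it below -/
import Mathlib

section
/- For every n ≥ 1, there exists an irredundant tropical product of exactly binom(n+1, 3) lossy phone call matrices in G_n, i.e., a product from which no factor can be deleted without changing its value. -/
open scoped ENNReal

/-- Tropical (min-plus) matrix multiplication over [0,∞]. -/
noncomputable def tropMul {n : ℕ} (A B : Matrix (Fin n) (Fin n) ℝ≥0∞) :
    Matrix (Fin n) (Fin n) ℝ≥0∞ :=
  fun i j => Finset.univ.inf fun k => A i k + B k j

/-- The tropical identity matrix: 0 on the diagonal, ∞ elsewhere. -/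
noncomputable def tropId {n : ℕ} : Matrix (Fin n) (Fin n) ℝ≥0∞ :=
  fun i j => if i = j then 0 else ⊤

/-- The lossy phone call matrix C_{kl}(a): zero diagonal, value `a` at
positions (k,l) and (l,k), and ∞ elsewhere. -/
noncomputable def call {n : ℕ} (k l : Fin n) (a : ℝ≥0∞) : Matrix (Fin n) (Fin n) ℝ≥0∞ :=
  fun i j => if i = j then 0 else if (i = k ∧ j = l) ∨ (i = l ∧ j = k) then a else ⊤

/-- The tropical product of a list of lossy phone call matrices. -/
noncomputable def prodC {n : ℕ} (l : List (Fin n × Fin n × ℝ≥0∞)) : Matrix (Fin n) (Fin n) ℝ≥0∞ :=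
  (l.map fun t => call t.1 t.2.1 t.2.2).foldr tropMul tropId


namespace LossyAux

theorem prodC_cons {n : ℕ} (t : Fin n × Fin n × ℝ≥0∞) (L : List (Fin n × Fin n × ℝ≥0∞)) :
    prodC (t :: L) = tropMul (call t.1 t.2.1 t.2.2) (prodC L) := rfl

theorem tropMul_le {n : ℕ} (A B : Matrix (Fin n) (Fin n) ℝ≥0∞) (p k q : Fin n) :
    tropMul A B p q ≤ A p k + B k q :=
  Finset.inf_le (f := fun k => A p k + B k q) (Finset.mem_univ k)

theorem cons_le {n : ℕ} (t : Fin n × Fin n × ℝ≥0∞) (L : List (Fin n × Fin n × ℝ≥0∞))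
    (p q : Fin n) : prodC (t :: L) p q ≤ prodC L p q := by
  rw [prodC_cons]
  refine (tropMul_le _ _ p p q).trans ?_
  simp [call]

theorem le_of_sublist {n : ℕ} {L' L : List (Fin n × Fin n × ℝ≥0∞)} (h : L'.Sublist L) :
    ∀ p q, prodC L p q ≤ prodC L' p q := by
  induction h with
  | slnil => intro p q; exact le_rfl
  | cons a _ ih => intro p q; exact (cons_le _ _ _ _).trans (ih p q)
  | cons_cons a _ ih =>
    intro p q
    rw [prodC_cons, prodC_cons]
    refine Finset.le_inf fun k _ => (tropMul_le _ _ p k q).trans ?_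
    gcongr
    exact ih k q

/-- Paths of cost less than `M` starting at most at `S` end at most at `T`. -/
def Pres {n : ℕ} (M : ℝ≥0∞) (L : List (Fin n × Fin n × ℝ≥0∞)) (S T : ℕ) : Prop :=
  ∀ p q : Fin n, p.val ≤ S → prodC L p q < M → q.val ≤ T

theorem pres_nil {n : ℕ} {M : ℝ≥0∞} {S : ℕ} :
    Pres M ([] : List (Fin n × Fin n × ℝ≥0∞)) S S := by
  intro p q hp h
  by_cases hpq : p = q
  · exact hpq ▸ hp
  · simp [prodC, tropId, hpq] at h

theorem pres_mono {n : ℕ} {M : ℝ≥0∞} {L : List (Fin n × Fin n × ℝ≥0∞)} {S S' T : ℕ}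
    (hS : S ≤ S') (h : Pres M L S' T) : Pres M L S T :=
  fun p q hp hq => h p q (hp.trans hS) hq

def Step {n : ℕ} (M : ℝ≥0∞) (S : ℕ) (t : Fin n × Fin n × ℝ≥0∞) : Prop :=
  M ≤ t.2.2 ∨ (t.1.val ≤ S ↔ t.2.1.val ≤ S)

theorem pres_cons {n : ℕ} {M : ℝ≥0∞} {L : List (Fin n × Fin n × ℝ≥0∞)} {S T : ℕ}
    {t : Fin n × Fin n × ℝ≥0∞} (ht : Step M S t) (h : Pres M L S T) : Pres M (t :: L) S T := by
  intro p q hp hq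
  rw [prodC_cons, tropMul, Finset.inf_lt_iff] at hq
  obtain ⟨k, -, hk⟩ := hq
  have h1 : call t.1 t.2.1 t.2.2 p k < M := lt_of_le_of_lt le_self_add hk
  have h2 : prodC L k q < M := lt_of_le_of_lt le_add_self hk
  refine h k q ?_ h2
  unfold call at h1
  split_ifs at h1 with h3 h4
  · exact h3 ▸ hp
  · rcases ht with ht | ht
    · exact absurd h1 (not_lt.mpr ht)
    · rcases h4 with ⟨rfl, rfl⟩ | ⟨rfl, rfl⟩
      · exact ht.1 hp
      · exact ht.2 hp
  · simp at h1

theorem pres_append {n : ℕ} {M : ℝ≥0∞} {L L2 : List (Fin n × Fin n × ℝ≥0∞)} {S T : ℕ}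
    (hL : ∀ t ∈ L, Step M S t) (h : Pres M L2 S T) : Pres M (L ++ L2) S T := by
  induction L with
  | nil => exact h
  | cons a L ih =>
    exact pres_cons (hL a (by simp)) (ih fun t ht => hL t (by simp [ht]))

/-- The order on the triples (start, end, edge). -/
def R (x y : ℕ × ℕ × ℕ) : Prop :=
  y.1 < x.1 ∨ (x.1 = y.1 ∧ y.2.1 < x.2.1) ∨ (x.1 = y.1 ∧ x.2.1 = y.2.1 ∧ x.2.2 < y.2.2)

def block (i j : ℕ) : List (ℕ × ℕ × ℕ) := (List.range' i (j - i)).map fun e => (i, j, e)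

def row (m i : ℕ) : List (ℕ × ℕ × ℕ) := (List.range' (i + 1) (m - i)).reverse.flatMap (block i)

def trip (m : ℕ) : List (ℕ × ℕ × ℕ) := (List.range (m + 1)).reverse.flatMap (row m)

theorem mem_trip {m : ℕ} {x : ℕ × ℕ × ℕ} (h : x ∈ trip m) :
    x.1 ≤ x.2.2 ∧ x.2.2 < x.2.1 ∧ x.2.1 ≤ m := by
  simp only [trip, row, block, List.mem_flatMap, List.mem_reverse, List.mem_range,
    List.mem_range'_1, List.mem_map] at h
  obtain ⟨i, hi, j, hj, e, he, rfl⟩ := h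
  simp only
  omega

theorem pairwise_trip (m : ℕ) : (trip m).Pairwise R := by
  unfold trip
  rw [List.pairwise_flatMap]
  constructor
  · intro i _
    unfold row
    rw [List.pairwise_flatMap]
    constructor
    · intro j _
      unfold block
      rw [List.pairwise_map]
      exact (List.pairwise_lt_range' ..).imp fun h => Or.inr (Or.inr ⟨rfl, rfl, h⟩)
    · rw [List.pairwise_reverse]
      refine (List.pairwise_lt_range' ..).imp fun h => ?_
      intro x hx y hy
      simp only [block, List.mem_map] at hx hy
      obtain ⟨_, _, rfl⟩ := hx
      obtain ⟨_, _, rfl⟩ := hy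
      exact Or.inr (Or.inl ⟨rfl, h⟩)
  · rw [List.pairwise_reverse]
    refine List.pairwise_lt_range.imp fun h => ?_
    intro x hx y hy
    simp only [row, block, List.mem_map, List.mem_flatMap] at hx hy
    obtain ⟨_, _, _, _, rfl⟩ := hx
    obtain ⟨_, _, _, _, rfl⟩ := hy
    exact Or.inl h

theorem sublist_flatMap {α β : Type*} {l : List α} {f : α → List β} {a : α} (h : a ∈ l) :
    (f a).Sublist (l.flatMap f) := by
  induction l with
  | nil => simp at h
  | cons b l ih =>
    rw [List.flatMap_cons]
    rcases List.mem_cons.1 h with rfl | h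
    · exact List.sublist_append_left _ _
    · exact (ih h).trans (List.sublist_append_right _ _)

theorem block_sublist {m i j : ℕ} (hij : i < j) (hj : j ≤ m) :
    (block i j).Sublist (trip m) := by
  have h1 : (block i j).Sublist (row m i) :=
    sublist_flatMap (by simp only [List.mem_reverse, List.mem_range'_1]; omega)
  exact h1.trans (sublist_flatMap (f := row m)
    (by simp only [List.mem_reverse, List.mem_range]; omega))

theorem length_row_aux (i k : ℕ) :
    ((List.range' (i + 1) k).map fun j => j - i).sum = (k + 1).choose 2 := by
  induction k with
  | zero => rfl
  | succ k ih =>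
    rw [List.range'_1_concat, List.map_append, List.sum_append, ih, Nat.choose_succ_succ (k + 1) 1]
    simp
    omega

theorem length_row (m i : ℕ) : (row m i).length = (m - i + 1).choose 2 := by
  simp [row, List.length_flatMap, List.map_reverse, List.sum_reverse, block, length_row_aux]

theorem length_trip_aux (m : ℕ) :
    ((List.range (m + 1)).map fun i => (m - i + 1).choose 2).sum = (m + 2).choose 3 := by
  induction m with
  | zero => rfl
  | succ m ih =>
    rw [List.range_succ_eq_map, List.map_cons, List.sum_cons, List.map_map]
    have : ((fun i => (m + 1 - i + 1).choose 2) ∘ Nat.succ) = fun i => (m - i + 1).choose 2 := by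
      funext i; simp
    rw [this, ih, Nat.choose_succ_succ (m + 2) 2]
    rfl

theorem length_trip (m : ℕ) : (trip m).length = (m + 2).choose 3 := by
  rw [← length_trip_aux]
  simp [trip, List.length_flatMap, List.map_reverse, List.sum_reverse, length_row]

noncomputable def toCall (m : ℕ) (x : ℕ × ℕ × ℕ) : Fin (m + 1) × Fin (m + 1) × ℝ≥0∞ :=
  (Fin.ofNat (m + 1) x.2.2, Fin.ofNat (m + 1) (x.2.2 + 1), (m + 1 : ℝ≥0∞) ^ (x.2.1 - x.1))

theorem toCall_fst {m : ℕ} {x : ℕ × ℕ × ℕ} (h : x.2.2 < m) : (toCall m x).1.val = x.2.2 := by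
  simp only [toCall, Fin.val_ofNat]
  exact Nat.mod_eq_of_lt (by omega)

theorem toCall_snd {m : ℕ} {x : ℕ × ℕ × ℕ} (h : x.2.2 < m) :
    (toCall m x).2.1.val = x.2.2 + 1 := by
  simp only [toCall, Fin.val_ofNat]
  exact Nat.mod_eq_of_lt (by omega)

theorem block_cost (m j : ℕ) (c : ℝ≥0∞) (k : ℕ) : ∀ i : ℕ, i + k = j → j ≤ m →
    prodC ((List.range' i k).map fun e =>
      ((Fin.ofNat (m + 1) e, Fin.ofNat (m + 1) (e + 1), c) :
        Fin (m + 1) × Fin (m + 1) × ℝ≥0∞)) (Fin.ofNat (m + 1) i) (Fin.ofNat (m + 1) j)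
      ≤ k * c := by
  induction k with
  | zero =>
    intro i hi _
    obtain rfl : i = j := by omega
    simp [prodC, tropId]
  | succ k ih =>
    intro i hi hj
    rw [List.range'_succ, List.map_cons, prodC_cons]
    refine (tropMul_le _ _ _ (Fin.ofNat (m + 1) (i + 1)) _).trans ?_
    have h1 := ih (i + 1) (by omega) hj
    have h2 : call (Fin.ofNat (m + 1) i) (Fin.ofNat (m + 1) (i + 1)) c
        (Fin.ofNat (m + 1) i) (Fin.ofNat (m + 1) (i + 1)) ≤ c := by
      unfold call
      split_ifs <;> simp_all
    calc _ ≤ c + k * c := add_le_add h2 h1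
      _ = _ := by push_cast; ring

theorem step_of {m M' S : ℕ} {x : ℕ × ℕ × ℕ} (hx : x ∈ trip m)
    (h : M' ≤ x.2.1 - x.1 ∨ x.2.2 ≠ S) :
    Step ((m + 1 : ℝ≥0∞) ^ M') S (toCall m x) := by
  obtain ⟨h1, h2, h3⟩ := mem_trip hx
  rcases h with h | h
  · left
    exact pow_le_pow_right₀ (by simp) h
  · right
    rw [toCall_fst (by omega), toCall_snd (by omega)]
    omega

/-- The part of the list before the erased call. -/
theorem pres_before {m : ℕ} {i j e T : ℕ} {L : List (ℕ × ℕ × ℕ)}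
    {L2 : List (Fin (m + 1) × Fin (m + 1) × ℝ≥0∞)} (hie : i ≤ e)
    (hmem : ∀ x ∈ L, x ∈ trip m) (hp : L.Pairwise R) (hR : ∀ x ∈ L, R x (i, j, e))
    (h : Pres ((m + 1 : ℝ≥0∞) ^ (j - i + 1)) L2 e T) :
    Pres ((m + 1 : ℝ≥0∞) ^ (j - i + 1)) (L.map (toCall m) ++ L2) i T := by
  induction L with
  | nil => exact pres_mono hie h
  | cons a L ih =>
    rw [List.pairwise_cons] at hp
    have ha := hR a (by simp)
    have ham := mem_trip (hmem a (by simp))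
    by_cases hB : a.1 = i ∧ a.2.1 = j
    · refine pres_mono hie (pres_append ?_ h)
      intro t ht
      obtain ⟨x, hx, rfl⟩ := List.mem_map.1 ht
      refine step_of (hmem x hx) (Or.inr ?_)
      have hxR := hR x hx
      rcases List.mem_cons.1 hx with rfl | hx'
      · simp only [R] at hxR; omega
      · have := hp.1 x hx'
        simp only [R] at hxR this; omega
    · rw [List.map_cons, List.cons_append]
      refine pres_cons (step_of (hmem a (by simp)) ?_) (ih (fun x hx => hmem x (by simp [hx])) hp.2
        (fun x hx => hR x (by simp [hx])))
      simp only [R] at ha; omega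

/-- The part of the list after the erased call. -/
theorem pres_after {m : ℕ} {i j e : ℕ} {L : List (ℕ × ℕ × ℕ)} (hej : e < j)
    (hmem : ∀ x ∈ L, x ∈ trip m) (hp : L.Pairwise R) (hR : ∀ x ∈ L, R (i, j, e) x) :
    Pres ((m + 1 : ℝ≥0∞) ^ (j - i + 1)) (L.map (toCall m)) e (j - 1) := by
  induction L with
  | nil => exact pres_mono (by omega) pres_nil
  | cons a L ih =>
    rw [List.pairwise_cons] at hp
    have ha := hR a (by simp)
    have ham := mem_trip (hmem a (by simp))
    by_cases hB : a.1 = i ∧ a.2.1 = j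
    · rw [List.map_cons]
      refine pres_cons (step_of (hmem a (by simp)) ?_) (ih (fun x hx => hmem x (by simp [hx])) hp.2
        (fun x hx => hR x (by simp [hx])))
      simp only [R] at ha; omega
    · refine pres_mono (S' := j - 1) (by omega) ?_
      rw [← List.append_nil (List.map _ _)]
      refine pres_append ?_ pres_nil
      intro t ht
      obtain ⟨x, hx, rfl⟩ := List.mem_map.1 ht
      have hxm := mem_trip (hmem x hx)
      refine step_of (hmem x hx) ?_
      have hxR := hR x hx
      rcases List.mem_cons.1 hx with rfl | hx'
      · simp only [R] at hxR; omega
      · have := hp.1 x hx'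
        simp only [R] at hxR this ha; omega

theorem main (m r : ℕ) (hr : r < (trip m).length) :
    prodC (((trip m).map (toCall m)).eraseIdx r) ≠ prodC ((trip m).map (toCall m)) := by
  obtain ⟨i, j, e, hx⟩ : ∃ i j e, (trip m)[r] = (i, j, e) := ⟨_, _, _, rfl⟩
  have hmem : (i, j, e) ∈ trip m := hx ▸ List.getElem_mem hr
  obtain ⟨h1, h2, h3⟩ := mem_trip hmem
  simp only at h1 h2 h3
  have hsplit : trip m = (trip m).take r ++ (i, j, e) :: (trip m).drop (r + 1) := by
    rw [← hx, ← List.drop_eq_getElem_cons hr, List.take_append_drop]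
  have hpw := pairwise_trip m
  rw [hsplit, List.pairwise_append, List.pairwise_cons] at hpw
  obtain ⟨hp1, ⟨hp2, hp3⟩, hp4⟩ := hpw
  have hpres : Pres ((m + 1 : ℝ≥0∞) ^ (j - i + 1))
      (((trip m).map (toCall m)).eraseIdx r) i (j - 1) := by
    rw [List.eraseIdx_eq_take_drop_succ, ← List.map_take, ← List.map_drop]
    exact pres_before h1 (fun x hx => List.mem_of_mem_take hx) hp1
      (fun x hx => hp4 x hx _ (by simp))
      (pres_after h2 (fun x hx => List.mem_of_mem_drop hx) hp3 hp2)
  intro heq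
  have hcost : prodC ((trip m).map (toCall m)) (Fin.ofNat (m + 1) i) (Fin.ofNat (m + 1) j)
      < (m + 1 : ℝ≥0∞) ^ (j - i + 1) := by
    have hsub := (block_sublist (show i < j by omega) h3).map (toCall m)
    refine (le_of_sublist hsub _ _).trans_lt ?_
    have hb := block_cost m j ((m + 1 : ℝ≥0∞) ^ (j - i)) (j - i) i (by omega) h3
    have : (block i j).map (toCall m) = (List.range' i (j - i)).map fun e =>
      ((Fin.ofNat (m + 1) e, Fin.ofNat (m + 1) (e + 1), (m + 1 : ℝ≥0∞) ^ (j - i)) :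
        Fin (m + 1) × Fin (m + 1) × ℝ≥0∞) := by
      simp [block, toCall, Function.comp_def]
    rw [this]
    refine hb.trans_lt ?_
    have hn : (j - i) * (m + 1) ^ (j - i) < (m + 1) ^ (j - i + 1) := by
      rw [pow_succ']
      exact Nat.mul_lt_mul_of_pos_right (by omega) (by positivity)
    exact_mod_cast hn
  rw [← heq] at hcost
  have := hpres _ _ (by rw [Fin.val_ofNat, Nat.mod_eq_of_lt (by omega)]) hcost
  rw [Fin.val_ofNat, Nat.mod_eq_of_lt (by omega)] at this
  omega

end LossyAux

theorem exists_long_irredundant (n : ℕ) (hn : 1 ≤ n) :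
    ∃ l : List (Fin n × Fin n × ℝ≥0∞),
      (∀ t ∈ l, t.1 ≠ t.2.1) ∧
      l.length = (n + 1).choose 3 ∧
      ∀ r < l.length, prodC (l.eraseIdx r) ≠ prodC l := by
  obtain ⟨m, rfl⟩ : ∃ m, n = m + 1 := ⟨n - 1, by omega⟩
  refine ⟨(LossyAux.trip m).map (LossyAux.toCall m), ?_, ?_, ?_⟩
  · intro t ht
    obtain ⟨x, hx, rfl⟩ := List.mem_map.1 ht
    obtain ⟨h1, h2, h3⟩ := LossyAux.mem_trip hx
    intro h
    have := congrArg Fin.val h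
    rw [LossyAux.toCall_fst (by omega), LossyAux.toCall_snd (by omega)] at this
    omega
  · rw [List.length_map, LossyAux.length_trip]
  · intro r hr
    rw [List.length_map] at hr
    exact LossyAux.main m r hr
end

section
/- Consider n gossipers where gossiper i initially knows only item i, and in each phone call the two participants exchange everything they know. Any sequence of calls such that in every call at least one participant learns at least one new item has length at most binom(n, 2), and this bound is attained (e.g., by the scenario where gossiper 1 calls gossipers i, i−1, …, 2 for each i = 2, …, n). -/
/-- One phone call: both participants end up knowing the union of their knowledge. -/
def gossipStep {n : ℕ} (s : Fin n → Finset (Fin n)) (c : Fin n × Fin n) :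
    Fin n → Finset (Fin n) :=
  fun j => if j = c.1 ∨ j = c.2 then s c.1 ∪ s c.2 else s j

/-- Knowledge state after a sequence of calls, starting from K_j = {j}. -/
def gossipState {n : ℕ} (calls : List (Fin n × Fin n)) : Fin n → Finset (Fin n) :=
  calls.foldl gossipStep (fun j => {j})

/-- A sequence of calls is informative if in every call at least one
participant learns something new. -/
def Informative {n : ℕ} (calls : List (Fin n × Fin n)) : Prop :=
  ∀ r (h : r < calls.length),
    gossipState (calls.take r) (calls.get ⟨r, h⟩).1 ≠
      gossipState (calls.take r) (calls.get ⟨r, h⟩).1 ∪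
        gossipState (calls.take r) (calls.get ⟨r, h⟩).2 ∨
    gossipState (calls.take r) (calls.get ⟨r, h⟩).2 ≠
      gossipState (calls.take r) (calls.get ⟨r, h⟩).1 ∪
        gossipState (calls.take r) (calls.get ⟨r, h⟩).2


lemma gossip_state_snoc {n : ℕ} (l : List (Fin n × Fin n)) (c : Fin n × Fin n) :
    gossipState (l ++ [c]) = gossipStep (gossipState l) c := by
  simp [gossipState, List.foldl_append]

lemma informative_snoc {n : ℕ} (l : List (Fin n × Fin n)) (c : Fin n × Fin n) :
    Informative (l ++ [c]) ↔ Informative l ∧ gossipState l c.1 ≠ gossipState l c.2 := by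
  have key : ∀ A B : Finset (Fin n), (A ≠ A ∪ B ∨ B ≠ A ∪ B) ↔ A ≠ B := by
    intro A B
    constructor
    · rintro h rfl
      simp at h
    · intro h
      by_contra hc
      push Not at hc
      exact h (hc.1.trans hc.2.symm)
  unfold Informative
  simp only [key]
  constructor
  · intro h
    constructor
    · intro r hr
      have := h r (by simp; omega)
      simpa [List.take_append_of_le_length hr.le, List.getElem_append_left hr] using this
    · have := h l.length (by simp)
      simpa using this
  · rintro ⟨h1, h2⟩ r hr
    by_cases hlt : r < l.length
    · have := h1 r hlt
      simpa [List.take_append_of_le_length hlt.le, List.getElem_append_left hlt] using this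
    · have : r = l.length := by simp at hr; omega
      subst this
      simpa using h2

/-- rotation in the plane of coordinates `k`, `l` -/
noncomputable def gRot {n : ℕ} (k l : Fin n) (c s : ℝ) : Matrix (Fin n) (Fin n) ℝ :=
  fun i j => if j = k then (if i = k then c else if i = l then s else 0)
    else if j = l then (if i = k then -s else if i = l then c else 0)
    else if i = j then 1 else 0

lemma mul_gRot {n : ℕ} {k l : Fin n} (hkl : k ≠ l) (c s : ℝ) (M : Matrix (Fin n) (Fin n) ℝ)
    (i j : Fin n) : (M * gRot k l c s) i j =
      if j = k then c * M i k + s * M i l else if j = l then -s * M i k + c * M i l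
      else M i j := by
  have aux : ∀ a b : ℝ, ∑ x, M i x * (if x = k then a else if x = l then b else 0)
      = a * M i k + b * M i l := by
    intro a b
    have : ∀ x, M i x * (if x = k then a else if x = l then b else 0)
        = (if x = k then a * M i k else 0) + (if x = l then b * M i l else 0) := by
      intro x
      by_cases h1 : x = k
      · subst h1; simp [hkl, mul_comm]
      · by_cases h2 : x = l
        · subst h2; simp [h1, mul_comm]
        · simp [h1, h2]
    simp only [this, Finset.sum_add_distrib, Finset.sum_ite_eq', Finset.mem_univ, if_true]
  rw [Matrix.mul_apply]
  unfold gRot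
  by_cases h1 : j = k
  · simp only [h1, if_true]; exact aux _ _
  · by_cases h2 : j = l
    · simp only [h2, hkl.symm, if_true, if_false]; exact aux _ _
    · simp [h1, h2]

lemma gRot_mul_transpose {n : ℕ} {k l : Fin n} (hkl : k ≠ l) (c s : ℝ) (h : c ^ 2 + s ^ 2 = 1) :
    gRot k l c s * (gRot k l c s).transpose = 1 := by
  have ht : (gRot k l c s).transpose = gRot k l c (-s) := by
    ext i j
    simp only [Matrix.transpose_apply, gRot]
    grind
  rw [ht]
  ext i j
  rw [mul_gRot hkl]
  simp only [gRot, Matrix.one_apply]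
  grind

/-- elementary skew matrix -/
noncomputable def gSkew {n : ℕ} (k l : Fin n) : Matrix (Fin n) (Fin n) ℝ :=
  Matrix.single k l 1 - Matrix.single l k 1

lemma mul_gSkew {n : ℕ} {k l : Fin n} (hkl : k ≠ l) (M : Matrix (Fin n) (Fin n) ℝ)
    (i j : Fin n) : (M * gSkew k l) i j =
      if j = k then - M i l else if j = l then M i k else 0 := by
  unfold gSkew
  rw [mul_sub, Matrix.sub_apply]
  by_cases h1 : j = k
  · subst h1; simp [hkl]
  · by_cases h2 : j = l
    · subst h2; simp [h1]
    · simp [h1, h2]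

lemma exists_generic {n : ℕ} (a b : Fin n → ℝ) : ∃ c s : ℝ, c ^ 2 + s ^ 2 = 1 ∧
    ∀ x, (a x ≠ 0 ∨ b x ≠ 0) → c * a x + s * b x ≠ 0 ∧ -s * a x + c * b x ≠ 0 := by
  let bad : Set ℝ := Set.range (fun x => - a x / b x) ∪ Set.range (fun x => b x / a x) ∪ {0}
  have hbad : bad.Finite :=
    ((Set.finite_range _).union (Set.finite_range _)).union (Set.finite_singleton 0)
  obtain ⟨t, ht⟩ := hbad.infinite_compl.nonempty
  simp only [bad, Set.mem_compl_iff, Set.mem_union, not_or, Set.mem_range, not_exists,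
    Set.mem_singleton_iff] at ht
  obtain ⟨⟨h1, h2⟩, h0⟩ := ht
  have hp : 0 < 1 + t ^ 2 := by positivity
  have hs : 0 < √(1 + t ^ 2) := Real.sqrt_pos.2 hp
  have hsq : √(1 + t ^ 2) ^ 2 = 1 + t ^ 2 := Real.sq_sqrt hp.le
  refine ⟨1 / √(1 + t ^ 2), t / √(1 + t ^ 2), ?_, ?_⟩
  · rw [div_pow, div_pow, hsq]; field_simp
  · intro x hx
    have e1 : a x + t * b x ≠ 0 := by
      intro h
      by_cases hb : b x = 0
      · simp [hb] at h hx; exact hx h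
      · apply h1 x; field_simp; linarith
    have e2 : -t * a x + b x ≠ 0 := by
      intro h
      by_cases ha : a x = 0
      · simp [ha] at h hx; exact hx h
      · apply h2 x; field_simp; linarith
    constructor
    · intro h
      apply e1
      field_simp at h
      linarith
    · intro h
      apply e2
      field_simp at h
      linarith

/-- certificate that the tangent space has dimension `r` -/
def GCert {n : ℕ} (K : Fin n → Finset (Fin n)) (r : ℕ) : Prop :=
  ∃ (g : Matrix (Fin n) (Fin n) ℝ) (V : Submodule ℝ (Matrix (Fin n) (Fin n) ℝ)),
    (∀ x j, x ∈ K j ↔ g x j ≠ 0) ∧ (∀ A ∈ V, A.transpose = -A) ∧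
    (∀ A ∈ V, ∀ x j, x ∉ K j → (g * A) x j = 0) ∧ r ≤ Module.finrank ℝ V

lemma GCert.step {n : ℕ} {K : Fin n → Finset (Fin n)} {r : ℕ} (h : GCert K r)
    (p : Fin n × Fin n) (hp : K p.1 ≠ K p.2) : GCert (gossipStep K p) (r + 1) := by
  obtain ⟨k, l⟩ := p
  obtain ⟨g, V, hg, hV, hgV, hr⟩ := h
  simp only at hp
  have hkl : k ≠ l := by rintro rfl; exact hp rfl
  obtain ⟨c, s, hcs, hgen⟩ := exists_generic (fun x => g x k) (fun x => g x l)
  set R := gRot k l c s with hR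
  have hRR : R * R.transpose = 1 := gRot_mul_transpose hkl c s hcs
  have hE : gSkew k l ∉ V := by
    intro hE
    apply hp
    ext x
    have h1 := hgV _ hE x k
    have h2 := hgV _ hE x l
    rw [mul_gSkew hkl] at h1 h2
    simp only [if_true, hkl.symm, if_false, neg_eq_zero] at h1 h2
    have a1 := hg x k
    have a2 := hg x l
    tauto
  let W := V ⊔ Submodule.span ℝ {gSkew k l}
  have hWlt : V < W := by
    refine lt_of_le_of_ne le_sup_left ?_
    intro h
    apply hE
    rw [h]
    exact (le_sup_right : _ ≤ W) (Submodule.mem_span_singleton_self _)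
  have hWr : r + 1 ≤ Module.finrank ℝ W := by
    have := Submodule.finrank_lt_finrank_of_lt hWlt
    omega
  have hWmem : ∀ A ∈ W, A.transpose = -A ∧
      ∀ x j, x ∉ gossipStep K (k, l) j → (g * (A * R)) x j = 0 := by
    intro A hA
    obtain ⟨B, hB, C, hC, rfl⟩ := Submodule.mem_sup.1 hA
    obtain ⟨t, rfl⟩ := Submodule.mem_span_singleton.1 hC
    have hsk : (gSkew k l).transpose = - gSkew k l := by
      simp [gSkew]
    refine ⟨by rw [Matrix.transpose_add, Matrix.transpose_smul, hV B hB, hsk]; simp [add_comm], ?_⟩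
    intro x j hx
    rw [← mul_assoc, mul_gRot hkl, mul_add, Matrix.mul_smul]
    simp only [Matrix.add_apply, Matrix.smul_apply, mul_gSkew hkl]
    have b := hgV B hB x
    have a1 := hg x k
    have a2 := hg x l
    simp only [gossipStep] at hx
    by_cases hj : j = k ∨ j = l
    · simp only [hj, if_true, Finset.mem_union, not_or] at hx
      have z1 : g x k = 0 := by tauto
      have z2 : g x l = 0 := by tauto
      simp only [z1, z2, b k hx.1, b l hx.2]
      rcases hj with rfl | rfl <;> simp
    · simp only [hj, if_false] at hx
      push Not at hj
      simp [hj.1, hj.2, b j hx]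
  let f : Matrix (Fin n) (Fin n) ℝ →ₗ[ℝ] Matrix (Fin n) (Fin n) ℝ :=
    { toFun := fun A => R.transpose * A * R
      map_add' := by intro A B; rw [mul_add, add_mul]
      map_smul' := by intro t A; simp }
  have hf : Function.Injective f := by
    intro A B hAB
    have h1 : R * (R.transpose * A * R) * R.transpose
      = R * (R.transpose * B * R) * R.transpose := by
      have : R.transpose * A * R = R.transpose * B * R := hAB
      rw [this]
    have h2 : ∀ A, R * (R.transpose * A * R) * R.transpose = A := by
      intro A
      calc R * (R.transpose * A * R) * R.transpose
          = (R * R.transpose) * A * (R * R.transpose) := by simp only [mul_assoc]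
        _ = A := by rw [hRR]; simp
    rwa [h2, h2] at h1
  refine ⟨g * R, W.map f, ?_, ?_, ?_, ?_⟩
  · intro x j
    rw [mul_gRot hkl]
    have a1 := hg x k
    have a2 := hg x l
    have a3 := hgen x
    have main : x ∈ K k ∪ K l ↔ (g x k ≠ 0 ∨ g x l ≠ 0) := by
      rw [Finset.mem_union, a1, a2]
    have back : ∀ u v : ℝ, u * g x k + v * g x l ≠ 0 → (g x k ≠ 0 ∨ g x l ≠ 0) := by
      intro u v h
      by_contra hc
      push Not at hc
      simp [hc.1, hc.2] at h
    simp only [gossipStep]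
    by_cases h1 : j = k
    · simp only [h1, true_or, if_true]
      rw [main]
      exact ⟨fun h => (a3 h).1, back _ _⟩
    · by_cases h2 : j = l
      · simp only [h2, or_true, if_true, hkl.symm, if_false]
        rw [main]
        exact ⟨fun h => (a3 h).2, back _ _⟩
      · simp only [h1, h2, or_self, if_false]
        exact hg x j
  · rintro _ ⟨A, hA, rfl⟩
    change (R.transpose * A * R).transpose = -(R.transpose * A * R)
    rw [Matrix.transpose_mul, Matrix.transpose_mul, (hWmem A hA).1]
    simp [mul_assoc]
  · rintro _ ⟨A, hA, rfl⟩ x j hx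
    change (g * R * (R.transpose * A * R)) x j = 0
    have : g * R * (R.transpose * A * R) = g * (A * R) := by
      calc g * R * (R.transpose * A * R) = g * (R * R.transpose) * (A * R) := by
            simp only [mul_assoc]
        _ = _ := by rw [hRR]; simp
    rw [this]
    exact (hWmem A hA).2 x j hx
  · rw [← (Submodule.equivMapOfInjective f hf W).finrank_eq]
    exact hWr

lemma GCert.of_informative {n : ℕ} (calls : List (Fin n × Fin n)) (h : Informative calls) :
    GCert (gossipState calls) calls.length := by
  induction calls using List.reverseRecOn with
  | nil =>
    refine ⟨1, ⊥, ?_, ?_, ?_, ?_⟩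
    · intro x j; simp [gossipState, Matrix.one_apply]
    · simp
    · simp
    · simp
  | append_singleton l c ih =>
    rw [informative_snoc] at h
    rw [gossip_state_snoc]
    simpa using (ih h.1).step c h.2

lemma sum_fin_choose (n : ℕ) : ∑ i : Fin n, (i : ℕ) = n.choose 2 := by
  rw [Fin.sum_univ_eq_sum_range (fun i => i), Finset.sum_range_id, Nat.choose_two_right]

lemma GCert.le {n : ℕ} {K : Fin n → Finset (Fin n)} {r : ℕ} (h : GCert K r) :
    r ≤ n.choose 2 := by
  obtain ⟨g, V, -, hV, -, hr⟩ := h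
  let f : V →ₗ[ℝ] ((Σ i : Fin n, Fin (i : ℕ)) → ℝ) :=
    { toFun := fun A p => A.1 p.1 ⟨p.2, p.2.2.trans p.1.2⟩
      map_add' := by intro A B; rfl
      map_smul' := by intro t A; rfl }
  have hf : Function.Injective f := by
    rw [injective_iff_map_eq_zero]
    intro A hA
    have hlow : ∀ i j : Fin n, j < i → A.1 i j = 0 := by
      intro i j hij
      exact congrFun hA ⟨i, ⟨j, hij⟩⟩
    have hsk : ∀ i j, A.1 j i = - A.1 i j := fun i j =>
      congrFun (congrFun (hV A.1 A.2) i) j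
    ext i j
    rcases lt_trichotomy i j with h | h | h
    · have := hsk j i
      rw [hlow j i h] at this
      simpa using this
    · subst h
      have := hsk i i
      have : A.1 i i = 0 := by linarith
      simpa using this
    · simpa using hlow i j h
  have := LinearMap.finrank_le_finrank_of_injective hf
  rw [Module.finrank_fintype_fun_eq_card, Fintype.card_sigma] at this
  simp only [Fintype.card_fin, sum_fin_choose] at this
  omega

/-- state in phase `i` after `t` calls -/
def GPhase (n i t : ℕ) : Prop :=
  ∃ calls : List (Fin n × Fin n), Informative calls ∧ calls.length = i.choose 2 + t ∧
    ∀ j x : Fin n, x ∈ gossipState calls j ↔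
      if j.val = 0 ∨ (i < j.val + t ∧ j.val ≤ i) then x.val ≤ i
      else if j.val ≤ i then x.val < i else x = j

lemma GPhase.step {n i t : ℕ} (hi : i < n) (ht : 1 ≤ t) (hti : t < i) (h : GPhase n i t) :
    GPhase n i (t + 1) := by
  obtain ⟨calls, h1, h2, h3⟩ := h
  let z : Fin n := ⟨0, by omega⟩
  let w : Fin n := ⟨i - t, by omega⟩
  refine ⟨calls ++ [(z, w)], ?_, ?_, ?_⟩
  · rw [informative_snoc]
    refine ⟨h1, fun he => ?_⟩
    have hz := h3 z ⟨i, hi⟩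
    have hw := h3 w ⟨i, hi⟩
    simp only at he
    rw [he, hw] at hz
    simp only [z, w] at hz
    grind
  · simp [h2]; omega
  · intro j x
    rw [gossip_state_snoc]
    simp only [gossipStep]
    have hj := h3 j x
    have hz := h3 z x
    have hw := h3 w x
    by_cases hjj : j = z ∨ j = w
    · rw [if_pos hjj, Finset.mem_union, hz, hw]
      simp only [Fin.ext_iff, z, w] at *
      grind
    · rw [if_neg hjj, hj]
      simp only [Fin.ext_iff, z, w] at *
      grind

lemma GPhase.next {n i : ℕ} (hi : i + 1 < n) (h : GPhase n i i) :
    GPhase n (i + 1) 1 := by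
  obtain ⟨calls, h1, h2, h3⟩ := h
  let z : Fin n := ⟨0, by omega⟩
  let w : Fin n := ⟨i + 1, by omega⟩
  refine ⟨calls ++ [(z, w)], ?_, ?_, ?_⟩
  · rw [informative_snoc]
    refine ⟨h1, fun he => ?_⟩
    have hz := h3 z z
    have hw := h3 w z
    simp only at he
    rw [he, hw] at hz
    simp only [z, w, Fin.ext_iff] at hz
    grind
  · simp [h2, Nat.choose_succ_succ' i 1]; omega
  · intro j x
    rw [gossip_state_snoc]
    simp only [gossipStep]
    have hj := h3 j x
    have hz := h3 z x
    have hw := h3 w x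
    by_cases hjj : j = z ∨ j = w
    · rw [if_pos hjj, Finset.mem_union, hz, hw]
      simp only [Fin.ext_iff, z, w] at *
      grind
    · rw [if_neg hjj, hj]
      simp only [Fin.ext_iff, z, w] at *
      grind

lemma GPhase.full {n i : ℕ} (hi : i < n) : GPhase n i i := by
  induction i with
  | zero =>
    refine ⟨[], ?_, by simp, ?_⟩
    · intro r h; simp at h
    · intro j x
      simp only [gossipState, List.foldl_nil, Finset.mem_singleton, Fin.ext_iff]
      grind
  | succ i ih =>
    have h1 := (ih (by omega)).next hi
    have : ∀ t, 1 ≤ t → t ≤ i + 1 → GPhase n (i + 1) t := by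
      intro t ht
      induction t, ht using Nat.le_induction with
      | base => intro _; exact h1
      | succ t ht iht => intro hle; exact (iht (by omega)).step hi ht (by omega)
    exact this _ (by omega) le_rfl

theorem informative_length_bound (n : ℕ) :
    (∀ calls : List (Fin n × Fin n), Informative calls →
      calls.length ≤ n.choose 2) ∧
    (∃ calls : List (Fin n × Fin n), Informative calls ∧
      calls.length = n.choose 2) := by
  refine ⟨fun calls h => (GCert.of_informative calls h).le, ?_⟩
  rcases n with _ | n
  · exact ⟨[], by intro r h; simp at h, by simp⟩
  · obtain ⟨calls, h1, h2, -⟩ := GPhase.full (n := n + 1) (i := n) (by omega)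
    refine ⟨calls, h1, ?_⟩
    rw [h2, Nat.choose_succ_succ' n 1]
    simp [add_comm]
end

section
/- In the monoid generated under tropical multiplication by the matrices C_{kl}(0) (zero diagonal, 0 at positions (k,l) and (l,k), ∞ elsewhere), every irredundant product of such matrices has at most binom(n, 2) factors. -/
open scoped ENNReal

/-- The tropical product of a list of (lossless) phone call matrices C_{kl}(0). -/
noncomputable def prodC0 {n : ℕ} (l : List (Fin n × Fin n)) : Matrix (Fin n) (Fin n) ℝ≥0∞ :=
  (l.map fun p => call p.1 p.2 0).foldr tropMul tropId


/-- Zero pattern of multiplication by a lossless call. -/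
lemma tropMul_call_zero {n : ℕ} (k l : Fin n) (M : Matrix (Fin n) (Fin n) ℝ≥0∞) (i j : Fin n) :
    tropMul (call k l 0) M i j = 0 ↔
      M i j = 0 ∨ (i = k ∧ M l j = 0) ∨ (i = l ∧ M k j = 0) := by
  have h1 : tropMul (call k l 0) M i j = 0 ↔ ∃ m, call k l 0 i m + M m j = 0 := by
    unfold tropMul
    constructor
    · intro h
      obtain ⟨m, -, hm⟩ := Finset.exists_mem_eq_inf (Finset.univ : Finset (Fin n))
        ⟨i, Finset.mem_univ _⟩ (fun m => call k l 0 i m + M m j)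
      exact ⟨m, by rw [← hm]; exact h⟩
    · rintro ⟨m, hm⟩
      have := Finset.inf_le (f := fun m => call k l 0 i m + M m j) (Finset.mem_univ m)
      rw [hm] at this
      exact le_antisymm this bot_le
  rw [h1]
  simp only [add_eq_zero]
  unfold call
  constructor
  · rintro ⟨m, hm, hM⟩
    split_ifs at hm with h2 h3
    · subst h2; exact Or.inl hM
    · rcases h3 with ⟨rfl, rfl⟩ | ⟨rfl, rfl⟩ <;> simp [hM]
    · simp at hm
  · rintro (h | ⟨rfl, h⟩ | ⟨rfl, h⟩)
    · exact ⟨i, by simp, h⟩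
    · exact ⟨l, by simp, h⟩
    · exact ⟨k, by simp, h⟩

lemma prodC0_cons {n : ℕ} (p : Fin n × Fin n) (t : List (Fin n × Fin n)) :
    prodC0 (p :: t) = tropMul (call p.1 p.2 0) (prodC0 t) := rfl

lemma prodC0_dich {n : ℕ} (t : List (Fin n × Fin n)) (i j : Fin n) :
    prodC0 t i j = 0 ∨ prodC0 t i j = ⊤ := by
  induction t generalizing i j with
  | nil =>
    change (if i = j then (0 : ℝ≥0∞) else ⊤) = 0 ∨ (if i = j then (0 : ℝ≥0∞) else ⊤) = ⊤
    split_ifs <;> simp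
  | cons p t ih =>
    rw [prodC0_cons]
    unfold tropMul
    obtain ⟨m, -, hm⟩ := Finset.exists_mem_eq_inf (Finset.univ : Finset (Fin n))
        ⟨i, Finset.mem_univ _⟩ (fun m => call p.1 p.2 0 i m + prodC0 t m j)
    rw [hm]
    have hc : call p.1 p.2 0 i m = 0 ∨ call p.1 p.2 0 i m = ⊤ := by
      unfold call
      split_ifs <;> simp
    rcases hc with hc | hc <;> rcases ih m j with h | h <;> simp [hc, h]

lemma prodC0_congr {n : ℕ} (s t u : List (Fin n × Fin n)) (h : prodC0 t = prodC0 u) :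
    prodC0 (s ++ t) = prodC0 (s ++ u) := by
  induction s with
  | nil => exact h
  | cons p s ih => rw [List.cons_append, List.cons_append, prodC0_cons, prodC0_cons, ih]

/-- Generic rotation coefficients. -/
lemma exists_rot {n : ℕ} (x y : Fin n → ℝ) :
    ∃ c s : ℝ, c ^ 2 + s ^ 2 = 1 ∧
      ∀ j, (c * x j - s * y j = 0 ↔ x j = 0 ∧ y j = 0) ∧
        (s * x j + c * y j = 0 ↔ x j = 0 ∧ y j = 0) := by
  classical
  obtain ⟨t, ht⟩ := Infinite.exists_notMem_finset
    (({0} : Finset ℝ) ∪ Finset.univ.image (fun j => x j / y j)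
      ∪ Finset.univ.image (fun j => - y j / x j))
  simp only [Finset.mem_union, Finset.mem_singleton, Finset.mem_image, Finset.mem_univ, true_and,
    not_or, not_exists] at ht
  obtain ⟨⟨h0, hx⟩, hy⟩ := ht
  have hp : 0 < 1 + t ^ 2 := by positivity
  have hs : Real.sqrt (1 + t ^ 2) ≠ 0 := (Real.sqrt_pos.mpr hp).ne'
  have hs2 : Real.sqrt (1 + t ^ 2) ^ 2 = 1 + t ^ 2 := Real.sq_sqrt hp.le
  refine ⟨1 / Real.sqrt (1 + t ^ 2), t / Real.sqrt (1 + t ^ 2), ?_, fun j => ⟨⟨fun h => ?_, ?_⟩,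
    ⟨fun h => ?_, ?_⟩⟩⟩
  · rw [div_pow, div_pow, hs2]; field_simp
  · field_simp at h
    by_cases hyj : y j = 0
    · simp [hyj] at h; exact ⟨h, hyj⟩
    · exact absurd (by rw [div_eq_iff hyj]; linarith) (hx j)
  · rintro ⟨h1, h2⟩; simp [h1, h2]
  · field_simp at h
    by_cases hxj : x j = 0
    · simp [hxj] at h; exact ⟨hxj, h⟩
    · exact absurd (by rw [div_eq_iff hxj]; linarith) (hy j)
  · rintro ⟨h1, h2⟩; simp [h1, h2]

/-- Orthogonal realisation of a gossip sequence together with a large space of skew matrices. -/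
lemma key {n : ℕ} (t : List (Fin n × Fin n)) (hd : ∀ p ∈ t, p.1 ≠ p.2)
    (hp : ∀ p u, p :: u <:+ t → prodC0 u ≠ prodC0 (p :: u)) :
    ∃ (P : Fin n → Fin n → ℝ) (W : Submodule ℝ (Fin n → Fin n → ℝ)),
      (∀ a b, ∑ j, P a j * P b j = if a = b then 1 else 0) ∧
      (∀ i j, P i j = 0 ↔ prodC0 t i j ≠ 0) ∧
      (∀ B ∈ W, ∀ i j, B i j = - B j i) ∧
      (∀ B ∈ W, ∀ i j, P i j = 0 → ∑ a, P i a * B a j = 0) ∧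
      t.length ≤ Module.finrank ℝ W := by
  induction t with
  | nil =>
    refine ⟨fun i j => if i = j then 1 else 0, ⊥, ?_, ?_, ?_, ?_, ?_⟩
    · intro a b; simp [eq_comm]
    · intro i j
      change _ ↔ (if i = j then (0 : ℝ≥0∞) else ⊤) ≠ 0
      split_ifs <;> simp_all
    · intro B hB; simp [(Submodule.mem_bot ℝ).1 hB]
    · intro B hB; simp [(Submodule.mem_bot ℝ).1 hB]
    · simp
  | cons p t ih =>
    obtain ⟨P, W, hO, hS, hA, hT, hr⟩ := ih (fun q hq => hd q (List.mem_cons_of_mem _ hq))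
      (fun q u h => hp q u (h.trans (List.suffix_cons p t)))
    obtain ⟨k, l⟩ := p
    have hkl : k ≠ l := hd (k, l) List.mem_cons_self
    have hne := hp (k, l) t (List.suffix_refl _)
    have hZ : ∀ i j, prodC0 ((k, l) :: t) i j = 0 ↔
      prodC0 t i j = 0 ∨ (i = k ∧ prodC0 t l j = 0) ∨ (i = l ∧ prodC0 t k j = 0) :=
      fun i j => tropMul_call_zero k l (prodC0 t) i j
    -- the new skew matrix
    set B0 : Fin n → Fin n → ℝ := fun a b => P k a * P l b - P l a * P k b with hB0
    have hPB : ∀ i j, ∑ a, P i a * B0 a j =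
        (if i = k then 1 else 0) * P l j - (if i = l then 1 else 0) * P k j := by
      intro i j
      rw [← hO i k, ← hO i l, Finset.sum_mul, Finset.sum_mul, ← Finset.sum_sub_distrib]
      exact Finset.sum_congr rfl fun a _ => by rw [hB0]; ring
    have hB0W : B0 ∉ W := by
      intro hmem
      apply hne
      funext i j
      by_cases h1 : prodC0 t i j = 0
      · rw [h1, (hZ i j).2 (Or.inl h1)]
      have hTij := hT B0 hmem i j ((hS i j).2 h1)
      rw [hPB] at hTij
      have h2 : ¬ prodC0 ((k, l) :: t) i j = 0 := by
        rw [hZ]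
        rintro (h | ⟨rfl, h⟩ | ⟨rfl, h⟩)
        · exact h1 h
        · simp [hkl] at hTij
          exact (hS _ _).1 hTij h
        · simp [hkl.symm] at hTij
          exact (hS _ _).1 hTij h
      rw [(prodC0_dich t i j).resolve_left h1, (prodC0_dich _ i j).resolve_left h2]
    obtain ⟨c, s, hcs, hg⟩ := exists_rot (P k) (P l)
    set Q : Fin n → Fin n → ℝ := fun i j =>
      if i = k then c * P k j - s * P l j else if i = l then s * P k j + c * P l j else P i j
      with hQ
    have hQk : ∀ j, Q k j = c * P k j - s * P l j := fun j => by simp [hQ]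
    have hQl : ∀ j, Q l j = s * P k j + c * P l j := fun j => by simp [hQ, hkl.symm]
    have hQo : ∀ i, i ≠ k → i ≠ l → ∀ j, Q i j = P i j := fun i h1 h2 j => by simp [hQ, h1, h2]
    have hQsum : ∀ (v : Fin n → ℝ) (i : Fin n), ∑ a, Q i a * v a =
        if i = k then c * ∑ a, P k a * v a - s * ∑ a, P l a * v a
        else if i = l then s * ∑ a, P k a * v a + c * ∑ a, P l a * v a
        else ∑ a, P i a * v a := by
      intro v i
      split_ifs with h1 h2
      · subst h1
        simp only [hQk, Finset.mul_sum, ← Finset.sum_sub_distrib]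
        exact Finset.sum_congr rfl fun a _ => by ring
      · subst h2
        simp only [hQl, Finset.mul_sum, ← Finset.sum_add_distrib]
        exact Finset.sum_congr rfl fun a _ => by ring
      · simp only [hQo i h1 h2]
    have hPQ : ∀ i b, ∑ a, P i a * Q b a =
        if b = k then c * (if k = i then 1 else 0) - s * (if l = i then 1 else 0)
        else if b = l then s * (if k = i then 1 else 0) + c * (if l = i then 1 else 0)
        else if b = i then 1 else 0 := by
      intro i b
      have := hQsum (P i) b
      simp only [hO] at this
      rw [← this]
      exact Finset.sum_congr rfl fun a _ => mul_comm _ _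
    have hT' : ∀ B : Fin n → Fin n → ℝ,
        (∀ i j, Q i j = 0 → (i = k ∨ i = l → (P k j = 0 ∧ P l j = 0)) →
          (i ≠ k → i ≠ l → P i j = 0) → ∑ a, Q i a * B a j = 0) →
        ∀ i j, Q i j = 0 → ∑ a, Q i a * B a j = 0 := by
      intro B h i j hij
      refine h i j hij ?_ ?_
      · rintro (rfl | rfl)
        · rw [hQk] at hij; exact (hg j).1.1 hij
        · rw [hQl] at hij; exact (hg j).2.1 hij
      · intro h1 h2; rw [← hQo i h1 h2]; exact hij
    have hB0T : ∀ i j, Q i j = 0 → ∑ a, Q i a * B0 a j = 0 := by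
      apply hT'
      intro i j _ h1 h2
      rw [hQsum]
      simp only [hPB]
      by_cases h3 : i = k
      · obtain ⟨h5, h6⟩ := h1 (Or.inl h3)
        simp [h5, h6]
      · by_cases h4 : i = l
        · obtain ⟨h5, h6⟩ := h1 (Or.inr h4)
          simp [h5, h6]
        · simp [h3, h4]
    have hWT : ∀ B ∈ W, ∀ i j, Q i j = 0 → ∑ a, Q i a * B a j = 0 := by
      intro B hB
      apply hT'
      intro i j _ h1 h2
      rw [hQsum]
      split_ifs with h3 h4
      · obtain ⟨h5, h6⟩ := h1 (Or.inl h3)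
        rw [hT B hB k j h5, hT B hB l j h6]; simp
      · obtain ⟨h5, h6⟩ := h1 (Or.inr h4)
        rw [hT B hB k j h5, hT B hB l j h6]; simp
      · exact hT B hB i j (h2 h3 h4)
    refine ⟨Q, W ⊔ Submodule.span ℝ {B0}, ?_, ?_, ?_, ?_, ?_⟩
    · intro a b
      rw [hQsum]
      simp only [hPQ]
      by_cases hak : a = k
      · subst hak
        by_cases hba : b = a
        · subst hba
          simp [hkl, hkl.symm]; linarith
        · by_cases hbl : b = l
          · subst hbl
            simp [hkl, hkl.symm]; ring
          · simp [hkl, hkl.symm, hba, hbl, Ne.symm hba]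
      · by_cases hal : a = l
        · subst hal
          by_cases hba : b = a
          · subst hba
            simp [hkl, hkl.symm]; linarith
          · by_cases hbk : b = k
            · subst hbk
              simp [hkl, hkl.symm]; ring
            · simp [hkl, hkl.symm, hba, hbk, Ne.symm hba]
        · by_cases hbk : b = k
          · subst hbk
            simp [hak, hal, Ne.symm hak, Ne.symm hal]
          · by_cases hbl : b = l
            · subst hbl
              simp [hak, hal, Ne.symm hak, Ne.symm hal]
            · simp [hak, hal, hbk, hbl, eq_comm]
    · intro i j
      rw [Ne, hZ]
      by_cases hik : i = k
      · subst hik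
        rw [hQk, (hg j).1, hS, hS]; simp [hkl]
      · by_cases hil : i = l
        · subst hil
          rw [hQl, (hg j).2, hS, hS]; simp [hkl.symm]; tauto
        · rw [hQo i hik hil, hS]; simp [hik, hil]
    · intro B hB i j
      obtain ⟨C, hC, D, hD, rfl⟩ := Submodule.mem_sup.1 hB
      obtain ⟨r, rfl⟩ := Submodule.mem_span_singleton.1 hD
      simp only [Pi.add_apply, Pi.smul_apply, smul_eq_mul, hB0]
      rw [hA C hC i j]; ring
    · intro B hB i j hij
      obtain ⟨C, hC, D, hD, rfl⟩ := Submodule.mem_sup.1 hB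
      obtain ⟨r, rfl⟩ := Submodule.mem_span_singleton.1 hD
      have e : ∑ a, Q i a * (C + r • B0) a j =
          ∑ a, Q i a * C a j + r * ∑ a, Q i a * B0 a j := by
        rw [Finset.mul_sum, ← Finset.sum_add_distrib]
        refine Finset.sum_congr rfl fun a _ => ?_
        simp only [Pi.add_apply, Pi.smul_apply, smul_eq_mul]; ring
      rw [e, hWT C hC i j hij, hB0T i j hij]; simp
    · have hlt : W < W ⊔ Submodule.span ℝ {B0} := by
        refine lt_of_le_of_ne le_sup_left fun h => hB0W ?_
        rw [h]
        exact Submodule.mem_sup_right (Submodule.mem_span_singleton_self B0)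
      have := Submodule.finrank_lt_finrank_of_lt hlt
      simp only [List.length_cons]
      omega

lemma skew_bound {n : ℕ} (W : Submodule ℝ (Fin n → Fin n → ℝ))
    (hA : ∀ B ∈ W, ∀ i j, B i j = - B j i) : Module.finrank ℝ W ≤ n.choose 2 := by
  let f : (Fin n → Fin n → ℝ) →ₗ[ℝ] ((Σ j : Fin n, Fin (j : ℕ)) → ℝ) :=
    { toFun := fun B x => B x.1 ⟨x.2, x.2.2.trans x.1.2⟩
      map_add' := fun _ _ => rfl
      map_smul' := fun _ _ => rfl }
  have hinj : Function.Injective (f.comp W.subtype) := by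
    rw [← LinearMap.ker_eq_bot, LinearMap.ker_eq_bot']
    rintro ⟨B, hB⟩ h
    have hlow : ∀ i j : Fin n, j < i → B i j = 0 := fun i j hij =>
      congrFun h (⟨i, ⟨j, hij⟩⟩ : Σ j : Fin n, Fin (j : ℕ))
    ext i j
    change B i j = 0
    rcases lt_trichotomy i j with hij | rfl | hij
    · rw [hA B hB, hlow j i hij, neg_zero]
    · have := hA B hB i i; linarith
    · exact hlow i j hij
  have h := LinearMap.finrank_le_finrank_of_injective hinj
  rw [Module.finrank_fintype_fun_eq_card, Fintype.card_sigma] at h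
  simp only [Fintype.card_fin] at h
  rw [Fin.sum_univ_eq_sum_range (fun j => j) n, Finset.sum_range_id, ← Nat.choose_two_right] at h
  exact h

theorem ordinary_irredundant_bound {n : ℕ}
    (l : List (Fin n × Fin n)) (hd : ∀ p ∈ l, p.1 ≠ p.2)
    (hirr : ∀ r < l.length, prodC0 (l.eraseIdx r) ≠ prodC0 l) :
    l.length ≤ n.choose 2 := by
  obtain ⟨P, W, -, -, hA, -, hr⟩ := key l hd (by
    rintro p u ⟨s, rfl⟩ h
    refine hirr s.length (by simp) ?_
    rw [List.eraseIdx_append_of_length_le le_rfl]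
    simpa using prodC0_congr s _ _ h)
  exact hr.trans (skew_bound W hA)
end
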